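/- Let C(x) = (1 − √(1 − 4x))/(2x). For every real x with 0 < |x| < 1/4, one has C(x) > 0 and log C(x) = Σ_{k≥1} ((2k−1)!/(k!·k!))·x^k, the series on the right converging to log C(x). -/

import Mathlib

/-- The generating function of the Catalan numbers. -/
noncomputable def catalanGF (x : ℝ) : ℝ := (1 - Real.sqrt (1 - 4 * x)) / (2 * x)

/-- The binomial coefficients of `(1 - 4 * x) ^ (-1 / 2)` are the central binomial coefficients. -/
lemma ringChoose_neg_half_mul_neg_four_pow (n : ℕ) :
    Ring.choose (-1 / 2 : ℝ) n * (-4) ^ n = n.centralBinom := by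
  induction n with
  | zero => simp
  | succ n ih =>
    have h := Ring.choose_smul_choose (-1 / 2 : ℝ) (Nat.le_succ n)
    have hc : ((n : ℝ) + 1) * (n + 1).centralBinom = 2 * (2 * n + 1) * n.centralBinom := by
      exact_mod_cast Nat.succ_mul_centralBinom_succ n
    simp only [Nat.succ_eq_add_one, Nat.choose_succ_self_right, add_tsub_cancel_left,
      Ring.choose_one_right, nsmul_eq_mul, Nat.cast_add, Nat.cast_one] at h
    have hn : (n : ℝ) + 1 ≠ 0 := by positivity
    apply mul_left_cancel₀ hn
    rw [hc, ← ih, pow_succ]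
    linear_combination (-4) ^ n * (-4) * h

lemma hasSum_centralBinom_mul_pow {x : ℝ} (hx : |x| < 1 / 4) :
    HasSum (fun n : ℕ => (n.centralBinom : ℝ) * x ^ n) (1 / √(1 - 4 * x)) := by
  have hmem : -4 * x ∈ Metric.eball (0 : ℝ) 1 := by
    rw [← ENNReal.ofReal_one, Metric.eball_ofReal, mem_ball_zero_iff, Real.norm_eq_abs, abs_mul]
    norm_num
    linarith
  have h := (Real.one_add_rpow_hasFPowerSeriesOnBall_zero (a := -1 / 2)).hasSum hmem
  have hpos : 0 ≤ 1 - 4 * x := by linarith [(abs_lt.mp hx).2]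
  convert! h using 1
  · ext n
    rw [binomialSeries_apply, ← ringChoose_neg_half_mul_neg_four_pow]
    simp [← mul_pow, mul_assoc]
  · rw [Real.sqrt_eq_rpow, one_div, ← Real.rpow_neg hpos]
    ring_nf

lemma hasSum_centralBinom_succ_div_two_mul_pow {x : ℝ} (hx : |x| < 1 / 4) :
    HasSum (fun n : ℕ => ((n + 1).centralBinom : ℝ) / 2 * x ^ n)
      (2 / (√(1 - 4 * x) * (1 + √(1 - 4 * x)))) := by
  rcases eq_or_ne x 0 with rfl | hx0
  · convert! hasSum_single (f := fun n : ℕ => ((n + 1).centralBinom : ℝ) / 2 * 0 ^ n) 0 ?_ using 1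
    · norm_num [Nat.centralBinom]
    · intro n hn
      simp [hn]
  · have hpos : 0 < 1 - 4 * x := by linarith [(abs_lt.mp hx).2]
    have hs : 0 < √(1 - 4 * x) := Real.sqrt_pos.mpr hpos
    have hsq := Real.sq_sqrt hpos.le
    have h := ((hasSum_nat_add_iff' 1).mpr (hasSum_centralBinom_mul_pow hx)).div_const (2 * x)
    convert! h using 1
    · ext n
      field_simp
      ring
    · simp only [Finset.range_one, Finset.sum_singleton, Nat.centralBinom_zero, pow_zero]
      field_simp
      push_cast
      linear_combination hsq

lemma hasDerivAt_log_two_div_one_add_sqrt {x : ℝ} (hx : x < 1 / 4) :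
    HasDerivAt (fun y => Real.log (2 / (1 + √(1 - 4 * y))))
      (2 / (√(1 - 4 * x) * (1 + √(1 - 4 * x)))) x := by
  have hpos : 0 < 1 - 4 * x := by linarith
  have hs : 0 < √(1 - 4 * x) := Real.sqrt_pos.mpr hpos
  have h1 : HasDerivAt (fun y : ℝ => 1 - 4 * y) (-4) x := by
    simpa using ((hasDerivAt_id x).const_mul 4).const_sub 1
  have h2 := (((h1.sqrt hpos.ne').const_add 1).log (by positivity)).const_sub (Real.log 2)
  convert! h2 using 1
  · ext y
    exact Real.log_div two_ne_zero (by positivity)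
  · field_simp
    norm_num

/-- The logarithm of `2 / (1 + √(1 - 4 * x))` is the antiderivative vanishing at `0` of the series
`∑ n, (n + 1).centralBinom / 2 * x ^ n`. -/
lemma hasSum_log_two_div_one_add_sqrt {x : ℝ} (hx : |x| < 1 / 4) :
    HasSum (fun n : ℕ => ((n + 1).centralBinom : ℝ) / (2 * (n + 1)) * x ^ (n + 1))
      (Real.log (2 / (1 + √(1 - 4 * x)))) := by
  obtain ⟨r, hxr, hr⟩ := exists_between hx
  have hr0 : 0 < r := (abs_nonneg x).trans_lt hxr
  set t := Metric.ball (0 : ℝ) r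
  have ht : IsPreconnected t := (convex_ball 0 r).isPreconnected
  have hlt {y : ℝ} (hy : y ∈ t) : |y| < r := by simpa [t] using hy
  have hu := (hasSum_centralBinom_succ_div_two_mul_pow (by rwa [abs_of_pos hr0])).summable
  have hd (n : ℕ) (y : ℝ) :
      HasDerivAt (fun y => ((n + 1).centralBinom : ℝ) / (2 * (n + 1)) * y ^ (n + 1))
        (((n + 1).centralBinom : ℝ) / 2 * y ^ n) y := by
    convert! (hasDerivAt_pow (n + 1) y).const_mul _ using 1
    push_cast
    field_simp
  have hbound (n : ℕ) (y : ℝ) (hy : y ∈ t) :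
      ‖((n + 1).centralBinom : ℝ) / 2 * y ^ n‖ ≤ ((n + 1).centralBinom : ℝ) / 2 * r ^ n := by
    rw [norm_mul, norm_pow, Real.norm_of_nonneg (by positivity), Real.norm_eq_abs]
    gcongr
    exact (hlt hy).le
  have h0 : (0 : ℝ) ∈ t := Metric.mem_ball_self hr0
  have hxt : x ∈ t := by simpa [t] using hxr
  have hsum0 : Summable fun n : ℕ =>
      ((n + 1).centralBinom : ℝ) / (2 * (n + 1)) * (0 : ℝ) ^ (n + 1) := by
    simp [summable_zero]
  have hD (y : ℝ) (hy : y ∈ t) := hasDerivAt_tsum_of_isPreconnected hu Metric.isOpen_ball ht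
    (fun n y _ => hd n y) hbound h0 hsum0 hy
  have hL (y : ℝ) (hy : y ∈ t) :=
    hasDerivAt_log_two_div_one_add_sqrt ((le_abs_self y).trans_lt ((hlt hy).trans hr))
  have heq := Metric.isOpen_ball.eqOn_of_deriv_eq ht
    (fun y hy => (hD y hy).differentiableAt.differentiableWithinAt)
    (fun y hy => (hL y hy).differentiableAt.differentiableWithinAt)
    (fun y hy => by
      rw [(hD y hy).deriv, (hL y hy).deriv]
      exact (hasSum_centralBinom_succ_div_two_mul_pow ((hlt hy).trans hr)).tsum_eq)
    h0 (by norm_num) hxt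
  exact (summable_of_summable_hasDerivAt_of_isPreconnected hu Metric.isOpen_ball ht
    (fun n y _ => hd n y) hbound h0 hsum0 hxt).hasSum_iff.mpr heq

lemma catalanGF_eq_two_div_one_add_sqrt {x : ℝ} (hx0 : x ≠ 0) (hx : x ≤ 1 / 4) :
    catalanGF x = 2 / (1 + √(1 - 4 * x)) := by
  have hsq := Real.sq_sqrt (show 0 ≤ 1 - 4 * x by linarith)
  rw [catalanGF, div_eq_div_iff (by simpa) (by positivity)]
  linear_combination -hsq

lemma factorial_two_mul_succ_sub_one_div (k : ℕ) :
    (Nat.factorial (2 * (k + 1) - 1) : ℝ) /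
      ((Nat.factorial (k + 1) : ℝ) * (Nat.factorial (k + 1) : ℝ)) =
      ((k + 1).centralBinom : ℝ) / (2 * (k + 1)) := by
  have hc : ((k + 1).centralBinom : ℝ) =
      Nat.factorial (2 * (k + 1)) / (Nat.factorial (k + 1) * Nat.factorial (k + 1)) := by
    rw [Nat.centralBinom_eq_two_mul_choose, Nat.cast_choose ℝ (by lia)]
    congr 4
    lia
  have hf : (Nat.factorial (2 * (k + 1)) : ℝ) =
      2 * (k + 1) * Nat.factorial (2 * (k + 1) - 1) := by
    exact_mod_cast (Nat.mul_factorial_pred (by lia : 2 * (k + 1) ≠ 0)).symm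
  rw [hc, hf]
  field_simp

/-- For `0 < |x| < 1/4`, `catalanGF x > 0` and
`log (catalanGF x) = Σ_{k≥1} ((2k-1)!/(k!·k!))·x^k`. -/
theorem catalanGF_log_series (x : ℝ) (hx0 : 0 < |x|) (hx : |x| < 1 / 4) :
    0 < catalanGF x ∧
      HasSum
        (fun k : ℕ =>
          ((Nat.factorial (2 * (k + 1) - 1) : ℝ) /
            ((Nat.factorial (k + 1) : ℝ) * (Nat.factorial (k + 1) : ℝ))) * x ^ (k + 1))
        (Real.log (catalanGF x)) := by
  rw [catalanGF_eq_two_div_one_add_sqrt (abs_pos.mp hx0) ((le_abs_self x).trans hx.le)]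
  refine ⟨by positivity, ?_⟩
  simp only [factorial_two_mul_succ_sub_one_div]
  exact hasSum_log_two_div_one_add_sqrt hx
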